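/- If p ≡ 3 (mod 4), then the subgroup H = im θ has index 4 in G. -/

import Mathlib

noncomputable section

/-- `G̃ ⊆ GL₂(F_p) × F_{p²}ˣ`: the subgroup of pairs `(σ, u)` with `det σ = u²`. -/
def Gtilde (p : ℕ) [Fact p.Prime] :
    Subgroup (GL (Fin 2) (ZMod p) × (GaloisField p 2)ˣ) :=
  MonoidHom.eqLocus
    ((Units.map (algebraMap (ZMod p) (GaloisField p 2)).toMonoidHom).comp
      ((Matrix.GeneralLinearGroup.det).comp (MonoidHom.fst _ _)))
    ((powMonoidHom 2).comp (MonoidHom.snd _ _))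

/-- The homomorphism `λ ↦ (λ·I, λ^{(p+1)/2})`. -/
def scalarPair (p : ℕ) [Fact p.Prime] :
    (ZMod p)ˣ →* GL (Fin 2) (ZMod p) × (GaloisField p 2)ˣ :=
  (Units.map (Matrix.scalar (Fin 2)).toMonoidHom).prod
    ((powMonoidHom ((p + 1) / 2)).comp
      (Units.map (algebraMap (ZMod p) (GaloisField p 2)).toMonoidHom))

/-- The central subgroup `N = {(λ·I, λ^{(p+1)/2}) : λ ∈ F_pˣ}` of `G̃`. -/
def Ncen (p : ℕ) [Fact p.Prime] : Subgroup (Gtilde p) :=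
  Subgroup.comap (Gtilde p).subtype (scalarPair p).range

lemma scalarPair_central (p : ℕ) [Fact p.Prime] (lam : (ZMod p)ˣ)
    (h : GL (Fin 2) (ZMod p) × (GaloisField p 2)ˣ) :
    h * scalarPair p lam = scalarPair p lam * h := by
  refine Prod.ext ?_ ?_
  · apply Units.ext
    show (h.1 : Matrix (Fin 2) (Fin 2) (ZMod p)) * Matrix.scalar (Fin 2) (lam : ZMod p) =
      Matrix.scalar (Fin 2) (lam : ZMod p) * (h.1 : Matrix (Fin 2) (Fin 2) (ZMod p))
    exact (Matrix.scalar_commute (lam : ZMod p) (fun r => Commute.all _ r)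
      (h.1 : Matrix (Fin 2) (Fin 2) (ZMod p))).eq.symm
  · exact mul_comm _ _

instance Ncen_normal (p : ℕ) [Fact p.Prime] : (Ncen p).Normal := by
  constructor
  intro n hn g
  rw [Ncen, Subgroup.mem_comap, MonoidHom.mem_range] at hn ⊢
  obtain ⟨lam, hlam⟩ := hn
  refine ⟨lam, ?_⟩
  have : (Gtilde p).subtype (g * n * g⁻¹)
      = (g : GL (Fin 2) (ZMod p) × (GaloisField p 2)ˣ) * (Gtilde p).subtype n * (g : _)⁻¹ := by
    simp [map_mul]
  rw [this, ← hlam, scalarPair_central, mul_assoc]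
  simp

/-- `G = G̃/N`. -/
abbrev Gquot (p : ℕ) [Fact p.Prime] : Type := Gtilde p ⧸ Ncen p

/-- `θ : SL₂(F_p) → G`, sending `σ` to the class of `(σ, 1)`. -/
def theta (p : ℕ) [Fact p.Prime] :
    Matrix.SpecialLinearGroup (Fin 2) (ZMod p) →* Gquot p :=
  (QuotientGroup.mk' (Ncen p)).comp
    (MonoidHom.codRestrict ((Matrix.SpecialLinearGroup.toGL).prod 1) (Gtilde p)
      (by
        intro σ
        show (Units.map (algebraMap (ZMod p) (GaloisField p 2)).toMonoidHom)
            (Matrix.GeneralLinearGroup.det (Matrix.SpecialLinearGroup.toGL σ)) = (1 : (GaloisField p 2)ˣ) ^ 2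
        have hdet : Matrix.GeneralLinearGroup.det (Matrix.SpecialLinearGroup.toGL σ) = 1 := by
          apply Units.ext
          show Matrix.det (σ : Matrix (Fin 2) (Fin 2) (ZMod p)) = 1
          exact σ.prop
        rw [hdet, map_one, one_pow]))

/-- The inclusion of unit groups. -/
def iotaU (p : ℕ) [Fact p.Prime] : (ZMod p)ˣ →* (GaloisField p 2)ˣ :=
  Units.map (algebraMap (ZMod p) (GaloisField p 2)).toMonoidHom

lemma iotaU_injective (p : ℕ) [Fact p.Prime] : Function.Injective (iotaU p) :=
  Units.map_injective (algebraMap (ZMod p) (GaloisField p 2)).injective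

lemma mem_Gtilde (p : ℕ) [Fact p.Prime] (x : GL (Fin 2) (ZMod p) × (GaloisField p 2)ˣ) :
    x ∈ Gtilde p ↔ iotaU p (Matrix.GeneralLinearGroup.det x.1) = x.2 ^ 2 := Iff.rfl

/-- The projection to the second factor. -/
def sndU (p : ℕ) [Fact p.Prime] : Gtilde p →* (GaloisField p 2)ˣ :=
  (MonoidHom.snd _ _).comp (Gtilde p).subtype

/-- The subgroup of all `λ^{(p+1)/2}`. -/
def Bsub (p : ℕ) [Fact p.Prime] : Subgroup (GaloisField p 2)ˣ :=
  ((powMonoidHom ((p + 1) / 2) : (ZMod p)ˣ →* (ZMod p)ˣ).range).map (iotaU p)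

lemma card_Fp_units (p : ℕ) [Fact p.Prime] : Nat.card (ZMod p)ˣ = p - 1 := by
  rw [Nat.card_units, Nat.card_zmod]

lemma card_Fq_units (p : ℕ) [Fact p.Prime] : Nat.card (GaloisField p 2)ˣ = p ^ 2 - 1 := by
  rw [Nat.card_units, GaloisField.card p 2 two_ne_zero]

instance finite_Fq (p : ℕ) [Fact p.Prime] : Finite (GaloisField p 2) := by
  have hp := (Fact.out : p.Prime).pos
  exact (Nat.card_pos_iff.mp (GaloisField.card p 2 two_ne_zero ▸ pow_pos hp 2)).2

lemma card_Bsub (p : ℕ) [Fact p.Prime] (hp4 : p % 4 = 3) :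
    Nat.card (Bsub p) = (p - 1) / 2 := by
  unfold Bsub
  rw [Subgroup.card_map_of_injective (iotaU_injective p), IsCyclic.card_powMonoidHom_range,
    card_Fp_units]
  congr 1
  obtain ⟨m, rfl⟩ : ∃ m, p = 4 * m + 3 := ⟨p / 4, by omega⟩
  have h1 : 4 * m + 3 - 1 = 2 * (2 * m + 1) := by omega
  have h2 : (4 * m + 3 + 1) / 2 = 2 * (m + 1) := by omega
  rw [h1, h2, Nat.gcd_mul_left]
  have : Nat.gcd (2 * m + 1) (m + 1) = 1 := by
    have ha : 2 * m + 1 = m + (m + 1) := by ring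
    rw [ha, Nat.gcd_add_self_left]
    simp
  rw [this]

lemma sq_sub_one (p : ℕ) : p ^ 2 - 1 = (p - 1) * (p + 1) := by
  rw [mul_comm, ← Nat.sq_sub_sq, one_pow]

lemma range_iotaU (p : ℕ) [Fact p.Prime] :
    (iotaU p).range = (powMonoidHom (p - 1) : (GaloisField p 2)ˣ →* _).ker := by
  apply Subgroup.eq_of_le_of_card_ge
  · rintro _ ⟨x, rfl⟩
    rw [MonoidHom.mem_ker, powMonoidHom_apply, ← map_pow, ← card_Fp_units p, pow_card_eq_one',
      map_one]
  · rw [IsCyclic.card_powMonoidHom_ker, card_Fq_units, sq_sub_one, Nat.gcd_mul_right_left,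
      MonoidHom.range_eq_map, Subgroup.card_map_of_injective (iotaU_injective p),
      Subgroup.card_top, card_Fp_units]

lemma range_sndU (p : ℕ) [Fact p.Prime] :
    (sndU p).range = (powMonoidHom (2 * (p - 1)) : (GaloisField p 2)ˣ →* _).ker := by
  ext u
  have key : u ∈ (powMonoidHom (2 * (p - 1)) : (GaloisField p 2)ˣ →* _).ker ↔
      u ^ 2 ∈ (iotaU p).range := by
    rw [range_iotaU, MonoidHom.mem_ker, MonoidHom.mem_ker, powMonoidHom_apply, powMonoidHom_apply,
      pow_mul]
  rw [key]
  constructor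
  · rintro ⟨x, rfl⟩
    exact ⟨_, (mem_Gtilde p x.1).1 x.2⟩
  · rintro ⟨d, hd⟩
    have hdet : Matrix.det (!![(d : ZMod p), 0; 0, 1]) = d := by simp [Matrix.det_fin_two]
    refine ⟨⟨(Matrix.GeneralLinearGroup.mkOfDetNeZero !![(d : ZMod p), 0; 0, 1]
      (by rw [hdet]; exact d.ne_zero), u), ?_⟩, rfl⟩
    rw [mem_Gtilde, ← hd]
    congr 1
    exact Units.ext hdet

lemma card_range_sndU (p : ℕ) [Fact p.Prime] (hp4 : p % 4 = 3) :
    Nat.card (sndU p).range = 2 * (p - 1) := by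
  rw [range_sndU, IsCyclic.card_powMonoidHom_ker, card_Fq_units, sq_sub_one]
  apply Nat.gcd_eq_right
  rw [mul_comm]
  exact mul_dvd_mul_left _ (by omega)

lemma scalarPair_mem (p : ℕ) [Fact p.Prime] (hp4 : p % 4 = 3) (lam : (ZMod p)ˣ) :
    scalarPair p lam ∈ Gtilde p := by
  rw [mem_Gtilde]
  have h1 : Matrix.GeneralLinearGroup.det (scalarPair p lam).1 = lam ^ 2 := by
    apply Units.ext
    show Matrix.det (Matrix.scalar (Fin 2) (lam : ZMod p)) = _
    simp
  have h2 : (scalarPair p lam).2 = iotaU p lam ^ ((p + 1) / 2) := rfl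
  have h3 : (p + 1) / 2 * 2 = (p - 1) + 2 := by omega
  rw [h1, h2, ← pow_mul, h3, pow_add, ← map_pow _ _ (p - 1), ← card_Fp_units p, pow_card_eq_one',
    map_one, one_mul, map_pow]

lemma comap_range (p : ℕ) [Fact p.Prime] (hp4 : p % 4 = 3) :
    (theta p).range.comap (QuotientGroup.mk' (Ncen p)) = (Bsub p).comap (sndU p) := by
  ext x
  rw [Subgroup.mem_comap, Subgroup.mem_comap]
  constructor
  · rintro ⟨s, hs⟩
    obtain ⟨lam, hlam⟩ := (QuotientGroup.eq (s := Ncen p)).1 hs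
    have h := congrArg Prod.snd hlam
    refine ⟨lam ^ ((p + 1) / 2), ⟨lam, rfl⟩, ?_⟩
    rw [map_pow]
    refine h.trans ?_
    show (1 : (GaloisField p 2)ˣ)⁻¹ * _ = _
    rw [inv_one, one_mul]
    rfl
  · rintro ⟨_, ⟨lam, rfl⟩, h⟩
    have h' : iotaU p lam ^ ((p + 1) / 2) = x.1.2 := by
      rw [← map_pow]; exact h
    set n : Gtilde p := ⟨scalarPair p lam, scalarPair_mem p hp4 lam⟩ with hn
    have hy2 : (x * n⁻¹).1.2 = 1 := by
      show x.1.2 * (iotaU p lam ^ ((p + 1) / 2))⁻¹ = 1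
      rw [h', mul_inv_cancel]
    have hdet := (mem_Gtilde p _).1 (x * n⁻¹).2
    rw [hy2, one_pow, ← map_one (iotaU p)] at hdet
    have hdet' := iotaU_injective p hdet
    refine ⟨⟨(x * n⁻¹).1.1.1, congrArg Units.val hdet'⟩, ?_⟩
    refine (QuotientGroup.eq (s := Ncen p)).2 ⟨lam, ?_⟩
    show (n : GL (Fin 2) (ZMod p) × (GaloisField p 2)ˣ) = _
    rw [Subgroup.subtype_apply, Subgroup.coe_mul, Subgroup.coe_inv, eq_inv_mul_iff_mul_eq]
    have hx : (x : GL (Fin 2) (ZMod p) × (GaloisField p 2)ˣ) = ((x * n⁻¹ : Gtilde p) : _) * n.1 := by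
      rw [← Subgroup.coe_mul, inv_mul_cancel_right]
    rw [hx]
    congr 1
    refine Prod.ext ?_ ?_
    · apply Units.ext
      rfl
    · exact hy2.symm

/-- If `p ≡ 3 (mod 4)`, then the subgroup `H = im θ` has index `4`
in `G`. -/
theorem stmt_7 (p : ℕ) [Fact p.Prime] (hp2 : 2 < p) (hp4 : p % 4 = 3) :
    (theta p).range.index = 4 := by
  have hs : Function.Surjective (QuotientGroup.mk' (Ncen p)) := QuotientGroup.mk'_surjective _
  rw [← Subgroup.index_comap_of_surjective _ hs, comap_range p hp4, Subgroup.index_comap]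
  have hle : Bsub p ≤ (sndU p).range := by
    rintro _ ⟨_, ⟨lam, rfl⟩, rfl⟩
    refine ⟨⟨scalarPair p lam, scalarPair_mem p hp4 lam⟩, ?_⟩
    rw [powMonoidHom_apply, map_pow]
    rfl
  have h := Subgroup.relIndex_mul_relIndex ⊥ (Bsub p) (sndU p).range bot_le hle
  rw [Subgroup.relIndex_bot_left, Subgroup.relIndex_bot_left, card_Bsub p hp4,
    card_range_sndU p hp4] at h
  have h3 : 2 * (p - 1) = (p - 1) / 2 * 4 := by omega
  rw [h3] at h
  exact Nat.eq_of_mul_eq_mul_left (by omega) h
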